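/- arXiv:2409.20561 — 4 statements merged into one kernel-verified Lean document; each statement's English description precedes it below -/
import Mathlib

section
/- Let A and B be nonempty finite types, K ≥ 0 a real number, Qα a Hermitian matrix in Matrix A A ℂ whose operator norm (largest absolute eigenvalue) is at most K, and Qβ a Hermitian matrix in Matrix B B ℂ. Set Q = Qα ⊗ₖ 1 + 1 ⊗ₖ Qβ (Kronecker sum) in Matrix (A×B) (A×B) ℂ. Suppose v, w : A×B → ℂ satisfy Q.mulVec v = n • v and Q.mulVec w = m • w for real numbers n, m with |n − m| > 2K. Then for every matrix Fα in Matrix A A ℂ one has ⟨v, (Fα ⊗ₖ 1).mulVec w⟩ = ∑_{x ∈ A×B} conj(v x) · ((Fα ⊗ₖ 1).mulVec w) x = 0. -/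
open Kronecker

open Kronecker in
lemma kron_sum_apply_aux {A B : Type*} [Fintype A] [Fintype B] [DecidableEq A] [DecidableEq B]
    (P : Matrix A A ℂ) (R : Matrix B B ℂ) (v : A × B → ℂ) (c : ℂ)
    (h : (P ⊗ₖ (1 : Matrix B B ℂ) + (1 : Matrix A A ℂ) ⊗ₖ R).mulVec v = c • v) :
    P * Matrix.of (fun a b => v (a, b)) + Matrix.of (fun a b => v (a, b)) * R.transpose
      = c • Matrix.of (fun a b => v (a, b)) := by
  ext a b
  have := congrFun h (a, b)
  simp only [Matrix.mulVec, dotProduct, Matrix.add_apply, Matrix.kroneckerMap_apply,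
    Fintype.sum_prod_type, Matrix.one_apply, add_mul, Finset.sum_add_distrib] at this
  rw [Finset.sum_comm (f := fun x y => (if a = x then (1 : ℂ) else 0) * R b y * v (x, y))] at this
  simp at this
  simp [Matrix.mul_apply, mul_comm (v _), this]

/-- Lemma 1 (linear-algebra form): if `Q = Qα ⊗ₖ 1 + 1 ⊗ₖ Qβ` is a Kronecker sum with
`Qα` Hermitian of operator norm at most `K`, `Qβ` Hermitian, and `v`, `w` are eigenvectors
of `Q` with real eigenvalues `n`, `m` satisfying `|n - m| > 2K`, then
`⟨v, (Fα ⊗ₖ 1) w⟩ = 0` for every matrix `Fα`. -/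
theorem stmt_0 {A B : Type*} [Fintype A] [Fintype B] [DecidableEq A] [DecidableEq B]
    [Nonempty A] [Nonempty B]
    (K : ℝ) (hK : 0 ≤ K)
    (Qα : Matrix A A ℂ) (Qβ : Matrix B B ℂ)
    (hQα : Qα.IsHermitian) (hQβ : Qβ.IsHermitian)
    (hQαnorm : ‖Matrix.toEuclideanCLM (𝕜 := ℂ) Qα‖ ≤ K)
    (v w : A × B → ℂ) (n m : ℝ)
    (hv : (Qα ⊗ₖ (1 : Matrix B B ℂ) + (1 : Matrix A A ℂ) ⊗ₖ Qβ).mulVec v = (n : ℂ) • v)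
    (hw : (Qα ⊗ₖ (1 : Matrix B B ℂ) + (1 : Matrix A A ℂ) ⊗ₖ Qβ).mulVec w = (m : ℂ) • w)
    (hgap : |n - m| > 2 * K) :
    ∀ Fα : Matrix A A ℂ,
      ∑ x : A × B, (starRingEnd ℂ) (v x) * (Fα ⊗ₖ (1 : Matrix B B ℂ)).mulVec w x = 0 := by
  intro F
  have h1 := kron_sum_apply_aux Qα Qβ v n hv
  have h2 := kron_sum_apply_aux Qα Qβ w m hw
  set V : Matrix A B ℂ := Matrix.of (fun a b => v (a, b)) with hV
  set W : Matrix A B ℂ := Matrix.of (fun a b => w (a, b)) with hW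
  have h3 := congrArg Matrix.conjTranspose h1
  rw [Matrix.conjTranspose_add, Matrix.conjTranspose_mul, Matrix.conjTranspose_mul,
    Matrix.conjTranspose_smul, hQα.eq, hQβ.transpose.eq] at h3
  have h4 : (W * V.conjTranspose) * Qα - Qα * (W * V.conjTranspose)
      = ((n - m : ℝ) : ℂ) • (W * V.conjTranspose) := by
    have e1 := congrArg (fun Z => W * Z) h3
    have e2 := congrArg (fun Z => Z * V.conjTranspose) h2
    simp only [Matrix.mul_add, Matrix.add_mul, Matrix.mul_smul, Matrix.smul_mul,
      Matrix.mul_assoc] at e1 e2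
    rw [Complex.ofReal_sub, sub_smul, ← e2, Matrix.mul_assoc]
    have : star (n : ℂ) = n := Complex.conj_ofReal n
    rw [this] at e1
    rw [← e1]
    abel
  have hX : W * V.conjTranspose = 0 := by
    generalize W * V.conjTranspose = X at h4
    have h5 := congrArg (Matrix.toEuclideanCLM (𝕜 := ℂ)) h4
    rw [map_sub, map_mul, map_mul, map_smul] at h5
    apply (Matrix.toEuclideanCLM (n := A) (𝕜 := ℂ)).injective
    rw [map_zero]
    generalize Matrix.toEuclideanCLM (𝕜 := ℂ) X = x at *
    generalize Matrix.toEuclideanCLM (𝕜 := ℂ) Qα = q at *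
    have h6 := congrArg norm h5
    rw [norm_smul, Complex.norm_real, Real.norm_eq_abs] at h6
    have h7 := norm_sub_le (x * q) (q * x)
    have h8 := norm_mul_le x q
    have h9 := norm_mul_le q x
    by_contra hx
    have hpos : 0 < ‖x‖ := norm_pos_iff.mpr hx
    nlinarith
  have h10 : ∑ x : A × B, (starRingEnd ℂ) (v x) * (F ⊗ₖ (1 : Matrix B B ℂ)).mulVec w x
      = (V.conjTranspose * (F * W)).trace := by
    simp only [Matrix.trace, Matrix.diag, Matrix.mul_apply, Matrix.mulVec, dotProduct,
      Matrix.kroneckerMap_apply, Fintype.sum_prod_type, Matrix.one_apply]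
    rw [Finset.sum_comm]
    simp [hV, hW]
  rw [h10, Matrix.trace_mul_comm, Matrix.mul_assoc, hX]
  simp
end

section
/- Let A and B be nonempty finite types, K ≥ 0 a real number, Qα a Hermitian matrix in Matrix A A ℂ whose operator norm (largest absolute eigenvalue) is at most K, and Qβ a Hermitian matrix in Matrix B B ℂ. Set Q = Qα ⊗ₖ 1 + 1 ⊗ₖ Qβ (Kronecker sum) in Matrix (A×B) (A×B) ℂ. Suppose v, w : A×B → ℂ satisfy Q.mulVec v = n • v and Q.mulVec w = m • w for real numbers n, m with |n − m| > 2K. Then the partial trace over B of the outer product |v⟩⟨w| vanishes: for all i, i' ∈ A, ∑_{k ∈ B} v (i,k) · conj(w (i',k)) = 0. -/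
open Kronecker

theorem kron_aux {A B : Type*} [Fintype A] [Fintype B] [DecidableEq A] [DecidableEq B]
    (P : Matrix A A ℂ) (S : Matrix B B ℂ) (v : A × B → ℂ) (n : ℂ)
    (hv : (P ⊗ₖ (1 : Matrix B B ℂ) + (1 : Matrix A A ℂ) ⊗ₖ S).mulVec v = n • v) :
    P * (Matrix.of fun i k => v (i, k)) + (Matrix.of fun i k => v (i, k)) * S.transpose
      = n • (Matrix.of fun i k => v (i, k)) := by
  ext i k
  have h := congrFun hv (i, k)
  simp only [Matrix.mulVec, dotProduct, Fintype.sum_prod_type, Matrix.add_apply,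
    Matrix.kroneckerMap_apply, Matrix.one_apply, add_mul, Finset.sum_add_distrib,
    Pi.smul_apply, smul_eq_mul, mul_ite, ite_mul, mul_one, one_mul, mul_zero, zero_mul,
    Finset.sum_ite_eq, Finset.mem_univ, if_true] at h
  rw [Finset.sum_comm (f := fun x y => if i = x then S k y * v (x, y) else 0)] at h
  simp only [Finset.sum_ite_eq, Finset.mem_univ, if_true] at h
  simp only [Matrix.add_apply, Matrix.mul_apply, Matrix.of_apply, Matrix.transpose_apply,
    Matrix.smul_apply, smul_eq_mul]
  rw [← h]
  congr 1
  exact Finset.sum_congr rfl fun l _ => mul_comm _ _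

/-- If `Q = Qα ⊗ₖ 1 + 1 ⊗ₖ Qβ` is a Kronecker sum with `Qα` Hermitian of operator norm
at most `K`, `Qβ` Hermitian, and `v`, `w` are eigenvectors of `Q` with real eigenvalues
`n`, `m` satisfying `|n - m| > 2K`, then the partial trace over `B` of the outer product
`|v⟩⟨w|` vanishes. -/
theorem stmt_1 {A B : Type*} [Fintype A] [Fintype B] [DecidableEq A] [DecidableEq B]
    [Nonempty A] [Nonempty B]
    (K : ℝ) (hK : 0 ≤ K)
    (Qα : Matrix A A ℂ) (Qβ : Matrix B B ℂ)
    (hQα : Qα.IsHermitian) (hQβ : Qβ.IsHermitian)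
    (hQαnorm : ‖Matrix.toEuclideanCLM (𝕜 := ℂ) Qα‖ ≤ K)
    (v w : A × B → ℂ) (n m : ℝ)
    (hv : (Qα ⊗ₖ (1 : Matrix B B ℂ) + (1 : Matrix A A ℂ) ⊗ₖ Qβ).mulVec v = (n : ℂ) • v)
    (hw : (Qα ⊗ₖ (1 : Matrix B B ℂ) + (1 : Matrix A A ℂ) ⊗ₖ Qβ).mulVec w = (m : ℂ) • w)
    (hgap : |n - m| > 2 * K) :
    ∀ i i' : A, ∑ k : B, v (i, k) * (starRingEnd ℂ) (w (i', k)) = 0 := by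
  have h1 := kron_aux Qα Qβ v n hv
  have h2 := kron_aux Qα Qβ w m hw
  set V : Matrix A B ℂ := Matrix.of fun i k => v (i, k) with hV
  set W : Matrix A B ℂ := Matrix.of fun i k => w (i, k) with hW
  have h3 := congrArg Matrix.conjTranspose h2
  rw [Matrix.conjTranspose_add, Matrix.conjTranspose_mul, Matrix.conjTranspose_mul,
    Matrix.conjTranspose_smul, hQα.eq, hQβ.transpose.eq] at h3
  have h4 := congrArg (fun X => X * W.conjTranspose) h1
  have h5 := congrArg (fun X => V * X) h3
  simp only [add_mul, mul_add, Matrix.add_mul, Matrix.mul_add, Matrix.smul_mul,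
    Matrix.mul_smul, Matrix.mul_assoc, Complex.star_def, Complex.conj_ofReal] at h4 h5
  set R : Matrix A A ℂ := V * W.conjTranspose with hR
  have h6 : Qα * R - R * Qα = ((n - m : ℝ) : ℂ) • R := by
    rw [Complex.ofReal_sub, sub_smul, ← h4, ← h5, hR, Matrix.mul_assoc]
    abel
  have h7 : R = 0 := by
    have h8 := congrArg (Matrix.toEuclideanCLM (𝕜 := ℂ) (n := A)) h6
    rw [map_sub, map_mul, map_mul, map_smul] at h8
    set q := Matrix.toEuclideanCLM (𝕜 := ℂ) Qα
    set r := Matrix.toEuclideanCLM (𝕜 := ℂ) R with hr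
    have h9 : |n - m| * ‖r‖ ≤ 2 * K * ‖r‖ := by
      calc |n - m| * ‖r‖ = ‖q * r - r * q‖ := by
            rw [h8, norm_smul, Complex.norm_real, Real.norm_eq_abs]
        _ ≤ ‖q * r‖ + ‖r * q‖ := norm_sub_le _ _
        _ ≤ ‖q‖ * ‖r‖ + ‖r‖ * ‖q‖ := add_le_add (norm_mul_le _ _) (norm_mul_le _ _)
        _ ≤ 2 * K * ‖r‖ := by nlinarith [norm_nonneg r]
    have h10 : ‖r‖ = 0 := by
      by_contra hne
      have hpos : 0 < ‖r‖ := lt_of_le_of_ne (norm_nonneg r) (Ne.symm hne)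
      nlinarith
    have h11 : r = 0 := norm_eq_zero.mp h10
    exact (map_eq_zero_iff _ (Matrix.toEuclideanCLM (𝕜 := ℂ) (n := A)).injective).mp h11
  intro i i'
  have := congrFun (congrFun h7 i) i'
  simpa [hR, hV, hW, Matrix.mul_apply] using this
end

section
/- For every real J ≥ 1 and every real x with |x| ≤ J/2, one has |2·arcsin(√((J + x)/(2J + 1))) − 2·arcsin(√(J/(2J + 1))) − x/√(J(J + 1))| ≤ 4·x²/J². -/
lemma aux_deriv (J : ℝ) (hJ : 1 ≤ J) (t : ℝ) (ht : |t| ≤ J / 2) :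
    HasDerivAt (fun t => 2 * Real.arcsin (Real.sqrt ((J + t) / (2 * J + 1))))
      (1 / Real.sqrt ((J + t) * (J + 1 - t))) t := by
  obtain ⟨h1, h2⟩ := abs_le.mp ht
  have hp : 0 < J + t := by linarith
  have hq : 0 < J + 1 - t := by linarith
  have hD : 0 < 2 * J + 1 := by linarith
  have hu : 0 < (J + t) / (2 * J + 1) := by positivity
  have hv : 1 - (J + t) / (2 * J + 1) = (J + 1 - t) / (2 * J + 1) := by
    field_simp; ring
  have hs : 0 < Real.sqrt ((J + t) / (2 * J + 1)) := Real.sqrt_pos.mpr hu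
  have hsq := Real.sq_sqrt hu.le
  have hv0 : 0 < (J + 1 - t) / (2 * J + 1) := by positivity
  have hlt : Real.sqrt ((J + t) / (2 * J + 1)) ≠ 1 := by
    intro h
    rw [h] at hsq
    linarith
  have d1 : HasDerivAt (fun t => (J + t) / (2 * J + 1)) (1 / (2 * J + 1)) t :=
    ((hasDerivAt_id t).const_add J).div_const _
  have d2 := d1.sqrt hu.ne'
  have d3 := ((Real.hasDerivAt_arcsin (by linarith) hlt).comp t d2).const_mul 2
  refine d3.congr_deriv ?_
  rw [hsq, hv, Real.sqrt_mul hp.le, Real.sqrt_div hp.le, Real.sqrt_div hq.le]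
  have a1 : 0 < Real.sqrt (J + t) := Real.sqrt_pos.mpr hp
  have a2 : 0 < Real.sqrt (J + 1 - t) := Real.sqrt_pos.mpr hq
  have a3 : 0 < Real.sqrt (2 * J + 1) := Real.sqrt_pos.mpr hD
  have a4 := Real.sq_sqrt hD.le
  generalize Real.sqrt (2 * J + 1) = d at *
  rw [← a4]
  field_simp

lemma aux_bound (J : ℝ) (hJ : 1 ≤ J) (t : ℝ) (ht : |t| ≤ J / 2) :
    |1 / Real.sqrt ((J + t) * (J + 1 - t)) - 1 / Real.sqrt (J * (J + 1))|
      ≤ 4 * |t| / J ^ 2 := by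
  obtain ⟨h1, h2⟩ := abs_le.mp ht
  have hp : 0 < J + t := by linarith
  have hq : 0 < J + 1 - t := by linarith
  have ha : J / 2 ≤ Real.sqrt ((J + t) * (J + 1 - t)) := by
    apply Real.le_sqrt_of_sq_le
    nlinarith
  have hb : J ≤ Real.sqrt (J * (J + 1)) := by
    apply Real.le_sqrt_of_sq_le
    nlinarith
  have ha2 := Real.sq_sqrt (mul_pos hp hq).le
  have hb2 := Real.sq_sqrt (show 0 ≤ J * (J + 1) by positivity)
  generalize Real.sqrt ((J + t) * (J + 1 - t)) = a at *
  generalize Real.sqrt (J * (J + 1)) = b at *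
  have a0 : 0 < a := by linarith
  have b0 : 0 < b := by linarith
  have e : 1 / a - 1 / b = t * (t - 1) / (a * b * (a + b)) := by
    have : t * (t - 1) = b ^ 2 - a ^ 2 := by rw [ha2, hb2]; ring
    rw [this]; field_simp; ring
  have ht1 : |t - 1| ≤ 3 / 2 * J := by
    rw [abs_le]; constructor <;> linarith
  have hden : 3 / 4 * J ^ 3 ≤ a * b * (a + b) := by
    calc 3 / 4 * J ^ 3 = J / 2 * J * (J / 2 + J) := by ring
      _ ≤ _ := by gcongr
  rw [e, abs_div, abs_mul, abs_of_pos (show 0 < a * b * (a + b) by positivity)]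
  calc |t| * |t - 1| / (a * b * (a + b)) ≤ |t| * (3 / 2 * J) / (3 / 4 * J ^ 3) := by gcongr
    _ = 2 * |t| / J ^ 2 := by field_simp; ring
    _ ≤ _ := by gcongr; norm_num


/-- Taylor estimate from the proof of Lemma 2: for `J ≥ 1` and `|x| ≤ J/2`,
`|2 arcsin √((J+x)/(2J+1)) - 2 arcsin √(J/(2J+1)) - x/√(J(J+1))| ≤ 4 x² / J²`. -/
theorem stmt_7 (J : ℝ) (hJ : 1 ≤ J) (x : ℝ) (hx : |x| ≤ J / 2) :
    |2 * Real.arcsin (Real.sqrt ((J + x) / (2 * J + 1)))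
      - 2 * Real.arcsin (Real.sqrt (J / (2 * J + 1)))
      - x / Real.sqrt (J * (J + 1))| ≤ 4 * x ^ 2 / J ^ 2 := by
  have key := (convex_Icc (-|x|) |x|).norm_image_sub_le_of_norm_hasDerivWithin_le
    (f := fun t => 2 * Real.arcsin (Real.sqrt ((J + t) / (2 * J + 1)))
      - t / Real.sqrt (J * (J + 1)))
    (f' := fun t => 1 / Real.sqrt ((J + t) * (J + 1 - t)) - 1 / Real.sqrt (J * (J + 1)))
    (C := 4 * |x| / J ^ 2) (x := 0) (y := x)
    (fun t ht => ((aux_deriv J hJ t ((abs_le.mpr ht).trans hx)).sub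
      ((hasDerivAt_id t).div_const _)).hasDerivWithinAt)
    (fun t ht => (aux_bound J hJ t ((abs_le.mpr ht).trans hx)).trans (by
      have := abs_le.mpr ht
      gcongr))
    (show (0:ℝ) ∈ Set.Icc (-|x|) |x| from ⟨by simp, abs_nonneg x⟩)
    (show x ∈ Set.Icc (-|x|) |x| from abs_le.mp le_rfl)
  simp only [Real.norm_eq_abs, add_zero, zero_div, sub_zero] at key
  calc _ = _ := by congr 1; ring
    _ ≤ _ := key
    _ = _ := by rw [← sq_abs x]; ring
end

section
/- Let Δ : ℕ → ℤ satisfy |Δ(R)| ≤ R for all R ≥ 1 and (Δ(R))⁴ / R³ → 0 as R → ∞. Then the sequence R ↦ (choose(2R, (R + Δ(R)).toNat) · √(π·R) / 4^R) · exp((Δ(R))² / R) tends to 1 as R → ∞. -/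
open Filter

lemma aux_g (x : ℝ) (hx : |x| ≤ 1/2) :
    |(1+x) * Real.log (1+x) + (1-x) * Real.log (1-x) - x^2| ≤ 7 * x^4 := by
  have h1 := Real.abs_log_sub_add_sum_range_le (x := x) (by linarith) 3
  have h2 := Real.abs_log_sub_add_sum_range_le (x := -x) (by rw [abs_neg]; linarith) 3
  have hb : |x| ^ (3+1) / (1 - |x|) ≤ 2 * x^4 := by
    have : |x|^(3+1) = x^4 := by
      exact Even.pow_abs (by decide) x
    rw [this, div_le_iff₀ (by linarith)]
    nlinarith [show 0 ≤ x^4 by positivity]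
  rw [abs_neg] at h2
  replace h1 := abs_le.1 (h1.trans hb)
  replace h2 := abs_le.1 (h2.trans hb)
  simp only [Finset.sum_range_succ, Finset.sum_range_zero, sub_neg_eq_add] at h1 h2
  norm_num at h1 h2
  obtain ⟨hx1, hx2⟩ := abs_le.1 hx
  obtain ⟨e1, he1⟩ : ∃ e, e = x + x^2/2 + x^3/3 + Real.log (1-x) := ⟨_, rfl⟩
  obtain ⟨e2, he2⟩ : ∃ e, e = -x + x^2/2 + (-x)^3/3 + Real.log (1+x) := ⟨_, rfl⟩
  rw [← he1] at h1
  rw [← he2] at h2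
  have k1 : Real.log (1-x) = e1 - (x + x^2/2 + x^3/3) := by rw [he1]; ring
  have k2 : Real.log (1+x) = e2 - (-x + x^2/2 + (-x)^3/3) := by rw [he2]; ring
  have key : (1+x) * Real.log (1+x) + (1-x) * Real.log (1-x) - x^2
      = 2/3 * x^4 + (1+x)*e2 + (1-x)*e1 := by rw [k1, k2]; ring
  rw [key, abs_le]
  have h4 : 0 ≤ x^4 := by positivity
  constructor <;> nlinarith

lemma aux_fact (n : ℕ) (hn : 0 < n) :
    (n.factorial : ℝ) = Stirling.stirlingSeq n * (√(2 * n) * (n / Real.exp 1) ^ n) := by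
  rw [Stirling.stirlingSeq]
  have : (0:ℝ) < n := by exact_mod_cast hn
  field_simp

lemma aux_exp (a : ℕ) (r : ℝ) (ha : 0 < a) (hr : 0 < r) :
    Real.exp (-(a * Real.log (a / r))) = (r / a) ^ a := by
  have : (0:ℝ) < a := by exact_mod_cast ha
  rw [← mul_neg, ← Real.log_inv, inv_div, Real.exp_nat_mul, Real.exp_log (by positivity)]

lemma aux_eq (R a b : ℕ) (ha : 0 < a) (hb : 0 < b) (hab : a + b = 2 * R) :
    (Nat.choose (2 * R) a : ℝ) * √(Real.pi * R) / 4 ^ R =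
      Stirling.stirlingSeq (2 * R) * √Real.pi / (Stirling.stirlingSeq a * Stirling.stirlingSeq b)
      * (√(a / R) * √(b / R))⁻¹
      * Real.exp (-(a * Real.log (a / R)) + -(b * Real.log (b / R))) := by
  have hR : 0 < R := by omega
  have ha' : (0:ℝ) < a := by exact_mod_cast ha
  have hb' : (0:ℝ) < b := by exact_mod_cast hb
  have hR' : (0:ℝ) < R := by exact_mod_cast hR
  have sa : 0 < Stirling.stirlingSeq a := by
    obtain ⟨k, rfl⟩ := Nat.exists_eq_succ_of_ne_zero ha.ne'
    exact Stirling.stirlingSeq'_pos k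
  have sb : 0 < Stirling.stirlingSeq b := by
    obtain ⟨k, rfl⟩ := Nat.exists_eq_succ_of_ne_zero hb.ne'
    exact Stirling.stirlingSeq'_pos k
  rw [Real.exp_add, aux_exp a R ha hR', aux_exp b R hb hR', ← hab, Nat.cast_add_choose,
    aux_fact a ha, aux_fact b hb, aux_fact (a+b) (by omega)]
  have h2 : ((a + b : ℕ) : ℝ) = 2 * R := by rw [hab]; push_cast; ring
  have h4 : (4:ℝ)^R = 2^a * 2^b := by
    rw [← pow_add, hab, pow_mul]; norm_num
  rw [h2, h4]
  have hs : √(2 * (2 * (R:ℝ))) = 2 * √R := by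
    rw [← mul_assoc, Real.sqrt_mul (by norm_num), show (2:ℝ)*2 = 2^2 by norm_num,
      Real.sqrt_sq (by norm_num)]
  rw [hs, Real.sqrt_mul (by positivity) (a:ℝ), Real.sqrt_mul (by positivity) (b:ℝ),
    Real.sqrt_mul (by positivity) (R:ℝ), Real.sqrt_div ha'.le, Real.sqrt_div hb'.le]
  have : 0 < √(a:ℝ) := by positivity
  have : 0 < √(b:ℝ) := by positivity
  have : 0 < √(R:ℝ) := by positivity
  have q2 : √(2:ℝ)^2 = 2 := Real.sq_sqrt (by norm_num)
  simp only [div_pow, mul_pow, pow_add]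
  field_simp
  rw [q2]

theorem aux_main (Δ : ℕ → ℤ)
    (hΔ4 : Tendsto (fun R : ℕ => ((Δ R : ℝ)) ^ 4 / (R : ℝ) ^ 3) atTop (nhds 0)) :
    Tendsto (fun R : ℕ =>
        (Nat.choose (2 * R) (((R : ℤ) + Δ R).toNat) : ℝ)
          * Real.sqrt (Real.pi * R) / 4 ^ R
          * Real.exp ((Δ R : ℝ) ^ 2 / R))
      atTop (nhds 1) := by
  have hx : Tendsto (fun R : ℕ => (Δ R : ℝ) / R) atTop (nhds 0) := by
    have h := hΔ4.mul (tendsto_inv_atTop_nhds_zero_nat (𝕜 := ℝ))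
    have h' := h.sqrt.sqrt
    simp only [mul_zero, Real.sqrt_zero] at h'
    rw [tendsto_zero_iff_abs_tendsto_zero]
    refine h'.congr fun R => ?_
    have : (Δ R : ℝ)^4 / (R:ℝ)^3 * (R:ℝ)⁻¹ = (((Δ R : ℝ) / R)^2)^2 := by
      rw [← div_eq_mul_inv, div_div, ← pow_succ, ← pow_mul, div_pow]
    rw [this, Real.sqrt_sq (by positivity), Real.sqrt_sq_eq_abs]; rfl
  have hsmall : ∀ᶠ R : ℕ in atTop, |(Δ R : ℝ) / R| ≤ 1/2 := by
    have := (tendsto_zero_iff_abs_tendsto_zero _).1 hx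
    exact this.eventually_le_const (by norm_num)
  have hpos : ∀ᶠ R : ℕ in atTop, 0 < R := eventually_gt_atTop 0
  -- integer facts
  have hint : ∀ᶠ R : ℕ in atTop, 2 * |Δ R| ≤ R ∧ 0 < R := by
    filter_upwards [hsmall, hpos] with R h1 h2
    have h2' : (0:ℝ) < R := by exact_mod_cast h2
    rw [abs_div, abs_of_pos h2', div_le_iff₀ h2'] at h1
    refine ⟨?_, h2⟩
    have : (2:ℝ) * |(Δ R : ℝ)| ≤ R := by linarith
    exact_mod_cast this
  have hbig : ∀ s : ℕ → ℕ, (∀ᶠ R in atTop, R ≤ 2 * s R) → Tendsto s atTop atTop := by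
    intro s hs
    rw [tendsto_atTop]
    intro c
    filter_upwards [hs, eventually_ge_atTop (2*c)] with R h1 h2
    omega
  set a : ℕ → ℕ := fun R => ((R : ℤ) + Δ R).toNat with ha
  set b : ℕ → ℕ := fun R => ((R : ℤ) - Δ R).toNat with hb
  have hat : Tendsto a atTop atTop := by
    apply hbig
    filter_upwards [hint] with R h
    have := neg_abs_le (Δ R)
    simp only [ha]; omega
  have hbt : Tendsto b atTop atTop := by
    apply hbig
    filter_upwards [hint] with R h
    have := le_abs_self (Δ R)
    simp only [hb]; omega
  have h2t : Tendsto (fun R : ℕ => 2 * R) atTop atTop :=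
    hbig _ (Eventually.of_forall fun R => by omega)
  have S := Stirling.tendsto_stirlingSeq_sqrt_pi
  have hpi : √Real.pi ≠ 0 := by positivity
  have T1 : Tendsto (fun R => Stirling.stirlingSeq (2 * R) * √Real.pi /
      (Stirling.stirlingSeq (a R) * Stirling.stirlingSeq (b R))) atTop (nhds 1) := by
    have := ((S.comp h2t).mul_const (√Real.pi)).div ((S.comp hat).mul (S.comp hbt))
      (mul_ne_zero hpi hpi)
    rwa [div_self (mul_ne_zero hpi hpi)] at this
  have T2 : Tendsto (fun R : ℕ => (√(1 + (Δ R : ℝ) / R) * √(1 - (Δ R : ℝ) / R))⁻¹)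
      atTop (nhds 1) := by
    have := ((hx.const_add 1).sqrt.mul (hx.const_sub 1).sqrt).inv₀ (by simp)
    simpa using this
  have T3 : Tendsto (fun R : ℕ => (R:ℝ) * ((1 + (Δ R : ℝ) / R) * Real.log (1 + (Δ R : ℝ) / R)
      + (1 - (Δ R : ℝ) / R) * Real.log (1 - (Δ R : ℝ) / R) - ((Δ R : ℝ) / R)^2))
      atTop (nhds 0) := by
    have h7 := hΔ4.const_mul 7
    rw [mul_zero] at h7
    refine squeeze_zero_norm' ?_ h7
    filter_upwards [hsmall, hpos] with R h1 h2
    have h2' : (0:ℝ) < R := by exact_mod_cast h2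
    rw [Real.norm_eq_abs, abs_mul, abs_of_pos h2']
    calc _ ≤ (R:ℝ) * (7 * ((Δ R : ℝ) / R)^4) := by gcongr; exact aux_g _ h1
      _ = _ := by field_simp
  have T4 := (Real.continuous_exp.tendsto _).comp T3.neg
  rw [neg_zero, Real.exp_zero] at T4
  have T := (T1.mul T2).mul T4
  rw [one_mul, one_mul] at T
  refine T.congr' ?_
  filter_upwards [hint] with R h
  have l1 := neg_abs_le (Δ R)
  have l2 := le_abs_self (Δ R)
  have a1 : (a R : ℤ) = R + Δ R := by simp only [ha]; omega
  have b1 : (b R : ℤ) = R - Δ R := by simp only [hb]; omega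
  have h2' : (0:ℝ) < R := by exact_mod_cast h.2
  have a2 : (a R : ℝ) = R * (1 + (Δ R : ℝ) / R) := by
    have : (a R : ℝ) = R + Δ R := by exact_mod_cast a1
    rw [this]; field_simp
  have b2 : (b R : ℝ) = R * (1 - (Δ R : ℝ) / R) := by
    have : (b R : ℝ) = R - Δ R := by exact_mod_cast b1
    rw [this]; field_simp
  have := aux_eq R (a R) (b R) (by omega) (by omega) (by omega)
  rw [this, mul_assoc _ (Real.exp _), ← Real.exp_add, a2, b2,
    mul_div_cancel_left₀ _ h2'.ne', mul_div_cancel_left₀ _ h2'.ne']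
  simp only [Function.comp]
  congr 2
  generalize Real.log (1 + (Δ R : ℝ) / R) = u
  generalize Real.log (1 - (Δ R : ℝ) / R) = v
  field_simp
  ring

/-- Stirling-type asymptotic for binomial coefficients (proof of Lemma 3): if
`|Δ(R)| ≤ R` for `R ≥ 1` and `Δ(R)⁴ / R³ → 0`, then
`choose(2R, R+Δ(R)) · √(πR) / 4^R · exp(Δ(R)²/R) → 1`. -/
theorem stmt_10 (Δ : ℕ → ℤ)
    (hΔ : ∀ R : ℕ, 1 ≤ R → |Δ R| ≤ (R : ℤ))
    (hΔ4 : Tendsto (fun R : ℕ => ((Δ R : ℝ)) ^ 4 / (R : ℝ) ^ 3) atTop (nhds 0)) :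
    Tendsto (fun R : ℕ =>
        (Nat.choose (2 * R) (((R : ℤ) + Δ R).toNat) : ℝ)
          * Real.sqrt (Real.pi * R) / 4 ^ R
          * Real.exp ((Δ R : ℝ) ^ 2 / R))
      atTop (nhds 1) := by
  exact aux_main Δ hΔ4
end
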